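/- arXiv:1708.06172 — 2 statements merged into one kernel-verified Lean document; each statement's English description precedes it below -/
import Mathlib

section
/- Let u : ℝ × ℝ³ → ℝ³, p : ℝ × ℝ³ → ℝ, and F : ℝ × ℝ³ → M₃(ℝ) be sufficiently smooth (say C²) and satisfy the Hookean viscoelastic system: ∂_t u + (u·∇)u − Δu + ∇p = ∇·(F·Fᵀ), ∂_t F + (u·∇)F = (∇u)·F, and div u = 0, pointwise. Then G = F·Fᵀ − I satisfies the Oldroyd-B type system pointwise: ∂_t u + (u·∇)u − Δu + ∇p = ∇·G and ∂_t G + (u·∇)G + Q₋₁(G, ∇u) = 2 D(u), where Q₋₁(G, ∇u) = G·Ω(u) − Ω(u)·G − (D(u)·G + G·D(u)) is the bilinear form Q with parameter b = −1. -/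
open Matrix

/-- `pd j f x` is the partial derivative `∂_j f (x)` of `f : ℝ³ → ℝ`. -/
noncomputable def pd (j : Fin 3) (f : (Fin 3 → ℝ) → ℝ) (x : Fin 3 → ℝ) : ℝ :=
  fderiv ℝ f x (Pi.single j 1)

theorem pd_sub_const (k : Fin 3) (f : (Fin 3 → ℝ) → ℝ) (c : ℝ) (x : Fin 3 → ℝ) :
    pd k (fun y => f y - c) x = pd k f x := by
  simp only [pd, fderiv_sub_const]

theorem pd_sum_mul {ι : Type*} [Fintype ι] (k : Fin 3) {f g : ι → (Fin 3 → ℝ) → ℝ}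
    {x : Fin 3 → ℝ} (hf : ∀ l, DifferentiableAt ℝ (f l) x)
    (hg : ∀ l, DifferentiableAt ℝ (g l) x) :
    pd k (fun y => ∑ l, f l y * g l y) x
      = ∑ l, (pd k (f l) x * g l x + f l x * pd k (g l) x) := by
  have h := HasFDerivAt.fun_sum (u := Finset.univ)
    fun l _ => (hf l).hasFDerivAt.mul (hg l).hasFDerivAt
  simp only [pd]
  refine (congrArg (fun L => L (Pi.single k 1)) h.fderiv).trans ?_
  simp only [_root_.sum_apply, _root_.add_apply, _root_.smul_apply, smul_eq_mul]
  exact Finset.sum_congr rfl fun l _ => by ring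

theorem deriv_sum_mul {ι : Type*} [Fintype ι] {f g : ι → ℝ → ℝ} {t : ℝ}
    (hf : ∀ l, DifferentiableAt ℝ (f l) t) (hg : ∀ l, DifferentiableAt ℝ (g l) t) :
    deriv (fun s => ∑ l, f l s * g l s) t
      = ∑ l, (deriv (f l) t * g l t + f l t * deriv (g l) t) :=
  (HasDerivAt.fun_sum (u := Finset.univ)
    fun l _ => (hf l).hasDerivAt.mul (hg l).hasDerivAt).deriv

/-- For `G = B - 1`, the form `Q₋₁(G, A)` is `2 D - (A B + B Aᵀ)`,
with `D` the symmetric part of `A`. -/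
theorem corotational_form_sub_one {n : Type*} [Fintype n] [DecidableEq n] (A B : Matrix n n ℝ) :
    (B - 1) * ((1/2 : ℝ) • (A - Aᵀ)) - ((1/2 : ℝ) • (A - Aᵀ)) * (B - 1)
        - (((1/2 : ℝ) • (A + Aᵀ)) * (B - 1) + (B - 1) * ((1/2 : ℝ) • (A + Aᵀ)))
      = (2 : ℝ) • ((1/2 : ℝ) • (A + Aᵀ)) - (A * B + B * Aᵀ) := by
  simp only [mul_sub, sub_mul, mul_add, add_mul, mul_one, one_mul, Matrix.mul_smul,
    Matrix.smul_mul]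
  module

/-- If `(u, p, F)` is a `C²` solution of the Hookean viscoelastic system
`∂_t u + (u·∇)u − Δu + ∇p = ∇·(F·Fᵀ)`, `∂_t F + (u·∇)F = (∇u)·F`, `div u = 0`,
then `G = F·Fᵀ − I` satisfies the Oldroyd-B type system
`∂_t u + (u·∇)u − Δu + ∇p = ∇·G` and `∂_t G + (u·∇)G + Q₋₁(G, ∇u) = 2 D(u)`,
where `Q₋₁(G, ∇u) = G·Ω(u) − Ω(u)·G − (D(u)·G + G·D(u))`. -/
theorem stmt_8
    (u : ℝ → (Fin 3 → ℝ) → (Fin 3 → ℝ))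
    (p : ℝ → (Fin 3 → ℝ) → ℝ)
    (F : ℝ → (Fin 3 → ℝ) → Matrix (Fin 3) (Fin 3) ℝ)
    (hu : ∀ i, ContDiff ℝ 2 (fun q : ℝ × (Fin 3 → ℝ) => u q.1 q.2 i))
    (hp : ContDiff ℝ 2 (fun q : ℝ × (Fin 3 → ℝ) => p q.1 q.2))
    (hF : ∀ i j, ContDiff ℝ 2 (fun q : ℝ × (Fin 3 → ℝ) => F q.1 q.2 i j))
    (gradu : ℝ → (Fin 3 → ℝ) → Matrix (Fin 3) (Fin 3) ℝ)
    (hgradu : ∀ t x i j, gradu t x i j = pd j (fun y => u t y i) x)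
    (D Ω : ℝ → (Fin 3 → ℝ) → Matrix (Fin 3) (Fin 3) ℝ)
    (hD : ∀ t x, D t x = (1/2 : ℝ) • (gradu t x + (gradu t x)ᵀ))
    (hΩ : ∀ t x, Ω t x = (1/2 : ℝ) • (gradu t x - (gradu t x)ᵀ))
    (hmom : ∀ t x (i : Fin 3),
      deriv (fun s => u s x i) t + (∑ k, u t x k * pd k (fun y => u t y i) x)
        - (∑ k, pd k (pd k (fun y => u t y i)) x) + pd i (fun y => p t y) x
        = ∑ j, pd j (fun y => (F t y * (F t y)ᵀ) i j) x)
    (hFeq : ∀ t x (i j : Fin 3),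
      deriv (fun s => F s x i j) t + (∑ k, u t x k * pd k (fun y => F t y i j) x)
        = ∑ k, pd k (fun y => u t y i) x * F t x k j)
    (hdiv : ∀ t x, ∑ k, pd k (fun y => u t y k) x = 0)
    (G : ℝ → (Fin 3 → ℝ) → Matrix (Fin 3) (Fin 3) ℝ)
    (hG : ∀ t x, G t x = F t x * (F t x)ᵀ - 1) :
    (∀ t x (i : Fin 3),
      deriv (fun s => u s x i) t + (∑ k, u t x k * pd k (fun y => u t y i) x)
        - (∑ k, pd k (pd k (fun y => u t y i)) x) + pd i (fun y => p t y) x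
        = ∑ j, pd j (fun y => G t y i j) x)
    ∧ (∀ t x (i j : Fin 3),
      deriv (fun s => G s x i j) t + (∑ k, u t x k * pd k (fun y => G t y i j) x)
        + (G t x * Ω t x - Ω t x * G t x - (D t x * G t x + G t x * D t x)) i j
        = 2 * D t x i j) := by
  have hFt : ∀ t x i j, DifferentiableAt ℝ (fun s => F s x i j) t := fun t x i j =>
    (((hF i j).differentiable (by norm_num)).comp
      (differentiable_id.prodMk (differentiable_const x))).differentiableAt
  have hFx : ∀ t x i j, DifferentiableAt ℝ (fun y => F t y i j) x := fun t x i j =>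
    (((hF i j).differentiable (by norm_num)).comp
      ((differentiable_const t).prodMk differentiable_id)).differentiableAt
  refine ⟨fun t x i => ?_, fun t x i j => ?_⟩
  · simp only [hmom, hG, Matrix.sub_apply, pd_sub_const]
  · have hQ := congrFun₂ (corotational_form_sub_one (gradu t x) (F t x * (F t x)ᵀ)) i j
    rw [← hD, ← hΩ, ← hG] at hQ
    rw [hQ]
    simp only [hG, Matrix.sub_apply, pd_sub_const, deriv_sub_const, Matrix.mul_apply,
      Matrix.transpose_apply]
    rw [deriv_sum_mul (fun l => hFt t x i l) (fun l => hFt t x j l)]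
    simp only [pd_sum_mul _ (fun l => hFx t x i l) (fun l => hFx t x j l)]
    have h := hFeq t x
    simp only [Matrix.add_apply, Matrix.smul_apply, Matrix.mul_apply, Matrix.transpose_apply,
      smul_eq_mul, hgradu, Fin.sum_univ_three] at h ⊢
    linear_combination F t x j 0 * h i 0 + F t x j 1 * h i 1 + F t x j 2 * h i 2
      + F t x i 0 * h j 0 + F t x i 1 * h j 1 + F t x i 2 * h j 2
end

section
/- Let u : ℝ × ℝ³ → ℝ³ and τ : ℝ × ℝ³ → M₃(ℝ) be smooth (C^∞) and satisfy the linearized Oldroyd-B system without pressure: ∂_t u = Δu + ∇·τ, ∂_t τ = D(u), and div u(t,·) = 0 for all t, pointwise. Then the vector field w = ∇·τ satisfies the damped wave equation ∂_t² w − Δ(∂_t w) − (1/2) Δw = 0 pointwise. -/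
open Matrix

/-- The space of smooth real functions on a normed space. -/
def smoothFunctions (E : Type*) [NormedAddCommGroup E] [NormedSpace ℝ E] :
    Submodule ℝ (E → ℝ) where
  carrier := {F | ContDiff ℝ (⊤ : ℕ∞) F}
  add_mem' {F G} (hF : ContDiff ℝ (⊤ : ℕ∞) F) (hG : ContDiff ℝ (⊤ : ℕ∞) G) :=
    show ContDiff ℝ (⊤ : ℕ∞) (F + G) from hF.add hG
  zero_mem' := (contDiff_const : ContDiff ℝ (⊤ : ℕ∞) fun _ : E => (0 : ℝ))
  smul_mem' c F (hF : ContDiff ℝ (⊤ : ℕ∞) F) :=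
    show ContDiff ℝ (⊤ : ℕ∞) (c • F) from hF.const_smul c

section DirDeriv

variable {E : Type*} [NormedAddCommGroup E] [NormedSpace ℝ E]

theorem contDiff_smoothFunctions (F : smoothFunctions E) :
    ContDiff ℝ (⊤ : ℕ∞) (F : E → ℝ) := F.2

theorem differentiable_smoothFunctions (F : smoothFunctions E) :
    Differentiable ℝ (F : E → ℝ) :=
  (contDiff_smoothFunctions F).differentiable (by simp)

/-- The derivative in direction `v`, as an endomorphism of the smooth functions. -/
noncomputable def dirDeriv (v : E) : smoothFunctions E →ₗ[ℝ] smoothFunctions E where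
  toFun F := ⟨fun q => fderiv ℝ (F : E → ℝ) q v,
    show ContDiff ℝ (⊤ : ℕ∞) (fun q => fderiv ℝ (F : E → ℝ) q v) from
      ((contDiff_smoothFunctions F).fderiv_right (m := (⊤ : ℕ∞)) (by simp)).clm_apply contDiff_const⟩
  map_add' F G := by
    ext q
    simp [fderiv_add (differentiable_smoothFunctions F q) (differentiable_smoothFunctions G q)]
  map_smul' c F := by
    ext q
    simp [fderiv_const_smul (differentiable_smoothFunctions F q) c]

theorem dirDeriv_apply (v : E) (F : smoothFunctions E) (q : E) :
    (dirDeriv v F : E → ℝ) q = fderiv ℝ F q v := rfl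

theorem dirDeriv_comm (v v' : E) (F : smoothFunctions E) :
    dirDeriv v (dirDeriv v' F) = dirDeriv v' (dirDeriv v F) := by
  have hd : Differentiable ℝ (fderiv ℝ (F : E → ℝ)) :=
    ((contDiff_smoothFunctions F).fderiv_right (m := (⊤ : ℕ∞)) (by simp)).differentiable (by simp)
  have key : ∀ (a b q : E), (dirDeriv a (dirDeriv b F) : E → ℝ) q
      = fderiv ℝ (fderiv ℝ (F : E → ℝ)) q a b := by
    intro a b q
    change fderiv ℝ (fun p => fderiv ℝ (F : E → ℝ) p b) q a = _
    rw [fderiv_clm_apply (hd q) (differentiableAt_const b)]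
    simp
  ext q
  rw [key, key]
  exact ((contDiff_smoothFunctions F).contDiffAt.isSymmSndFDerivAt (by simpa using WithTop.coe_le_coe.2 (le_top (a := (2 : ℕ∞))))) v v'

end DirDeriv

theorem deriv_time_eq_dirDeriv (F : smoothFunctions (ℝ × (Fin 3 → ℝ))) (t : ℝ)
    (x : Fin 3 → ℝ) :
    deriv (fun s => (F : ℝ × (Fin 3 → ℝ) → ℝ) (s, x)) t = (dirDeriv (1, 0) F).1 (t, x) := by
  have h : HasDerivAt (fun s : ℝ => (s, x)) (1, 0) t :=
    (hasDerivAt_id t).prodMk (hasDerivAt_const t x)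
  exact ((differentiable_smoothFunctions F (t, x)).hasFDerivAt.comp_hasDerivAt t h).deriv

theorem pd_eq_dirDeriv (F : smoothFunctions (ℝ × (Fin 3 → ℝ))) (j : Fin 3) (t : ℝ)
    (x : Fin 3 → ℝ) :
    pd j (fun y => (F : ℝ × (Fin 3 → ℝ) → ℝ) (t, y)) x
      = (dirDeriv (0, Pi.single j 1) F).1 (t, x) := by
  have h : HasFDerivAt (𝕜 := ℝ) (fun y : Fin 3 → ℝ => (t, y)) _ x :=
    (hasFDerivAt_const t x).prodMk (hasFDerivAt_id x)
  have := ((differentiable_smoothFunctions F (t, x)).hasFDerivAt.comp x h).fderiv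
  simp only [Function.comp_def] at this
  simp [pd, this, dirDeriv_apply]

/-- The algebraic derivation of the damped wave equation, for commuting operators. -/
theorem damped_wave_of_commuting {ι M : Type*} [Fintype ι] [AddCommGroup M] [Module ℝ M]
    (dt : M →ₗ[ℝ] M) (d : ι → M →ₗ[ℝ] M)
    (hdt : ∀ j F, dt (d j F) = d j (dt F)) (hd : ∀ i j F, d i (d j F) = d j (d i F))
    (U : ι → M) (T : ι → ι → M)
    (hU : ∀ i, dt (U i) = ∑ j, d j (d j (U i)) + ∑ j, d j (T i j))
    (hT : ∀ i j, dt (T i j) = (1/2 : ℝ) • (d j (U i) + d i (U j)))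
    (hdiv : ∑ k, d k (U k) = 0) (i : ι) :
    dt (dt (∑ j, d j (T i j))) - ∑ k, d k (d k (dt (∑ j, d j (T i j))))
      - (1/2 : ℝ) • ∑ k, d k (d k (∑ j, d j (T i j))) = 0 := by
  have hW : dt (∑ j, d j (T i j)) = (1/2 : ℝ) • ∑ j, d j (d j (U i)) := by
    have h0 : ∑ j, d j (d i (U j)) = 0 := by
      simp_rw [hd _ i, ← map_sum, hdiv, map_zero]
    simp_rw [map_sum, hdt, hT, map_smul, map_add, ← Finset.smul_sum, Finset.sum_add_distrib,
      h0, add_zero]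
  have hWt : dt ((1/2 : ℝ) • ∑ j, d j (d j (U i)))
      = (1/2 : ℝ) • ∑ k, d k (d k (∑ j, d j (d j (U i)) + ∑ j, d j (T i j))) := by
    simp_rw [← hU, map_smul, map_sum, hdt]
  rw [hW, hWt]
  simp_rw [map_smul, map_add, ← Finset.smul_sum, Finset.sum_add_distrib, smul_add]
  abel

/-- If smooth `u : ℝ × ℝ³ → ℝ³`, `τ : ℝ × ℝ³ → M₃(ℝ)` satisfy the linearized
Oldroyd-B system `∂_t u = Δu + ∇·τ`, `∂_t τ = D(u)`, `div u = 0`, then `w = ∇·τ`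
satisfies the damped wave equation `∂_t² w − Δ(∂_t w) − (1/2) Δw = 0`. -/
theorem stmt_10
    (u : ℝ → (Fin 3 → ℝ) → (Fin 3 → ℝ))
    (τ : ℝ → (Fin 3 → ℝ) → Matrix (Fin 3) (Fin 3) ℝ)
    (hu : ∀ i, ContDiff ℝ (⊤ : ℕ∞) (fun q : ℝ × (Fin 3 → ℝ) => u q.1 q.2 i))
    (hτ : ∀ i j, ContDiff ℝ (⊤ : ℕ∞) (fun q : ℝ × (Fin 3 → ℝ) => τ q.1 q.2 i j))
    (heq1 : ∀ t x (i : Fin 3),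
      deriv (fun s => u s x i) t
        = (∑ j, pd j (pd j (fun y => u t y i)) x) + ∑ j, pd j (fun y => τ t y i j) x)
    (heq2 : ∀ t x (i j : Fin 3),
      deriv (fun s => τ s x i j) t
        = (1/2 : ℝ) * (pd j (fun y => u t y i) x + pd i (fun y => u t y j) x))
    (hdiv : ∀ t x, ∑ k, pd k (fun y => u t y k) x = 0)
    (w : ℝ → (Fin 3 → ℝ) → (Fin 3 → ℝ))
    (hw : ∀ t x (i : Fin 3), w t x i = ∑ j, pd j (fun y => τ t y i j) x) :
    ∀ t x (i : Fin 3),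
      deriv (fun s => deriv (fun r => w r x i) s) t
        - (∑ j, pd j (pd j (fun y => deriv (fun s => w s y i) t)) x)
        - (1/2 : ℝ) * (∑ j, pd j (pd j (fun y => w t y i)) x) = 0 := by
  intro t x i
  let U : Fin 3 → smoothFunctions (ℝ × (Fin 3 → ℝ)) := fun i => ⟨_, hu i⟩
  let T : Fin 3 → Fin 3 → smoothFunctions (ℝ × (Fin 3 → ℝ)) := fun i j => ⟨_, hτ i j⟩
  let dt := dirDeriv (E := ℝ × (Fin 3 → ℝ)) (1, 0)
  let d : Fin 3 → _ := fun j => dirDeriv (E := ℝ × (Fin 3 → ℝ)) (0, Pi.single j 1)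
  have eU : ∀ t x i, u t x i = (U i).1 (t, x) := fun _ _ _ => rfl
  have eT : ∀ t x i j, τ t x i j = (T i j).1 (t, x) := fun _ _ _ _ => rfl
  have et : ∀ F t x, deriv (fun s => F.1 (s, x)) t = (dt F).1 (t, x) := deriv_time_eq_dirDeriv
  have ed : ∀ F j t, pd j (fun y => F.1 (t, y)) = fun x => (d j F).1 (t, x) :=
    fun F j t => funext (pd_eq_dirDeriv F j t)
  have esum : ∀ (F : Fin 3 → smoothFunctions (ℝ × (Fin 3 → ℝ))) q,
      ∑ j, (F j).1 q = (∑ j, F j).1 q := by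
    intro F q
    simp
  simp only [eU, eT, et, ed, esum] at heq1 heq2 hdiv hw
  simp only [hw, et, ed, esum]
  have key := damped_wave_of_commuting dt d (fun _ => dirDeriv_comm _ _)
    (fun _ _ => dirDeriv_comm _ _) U T
    (fun i => Subtype.ext (funext fun q => heq1 q.1 q.2 i))
    (fun i j => Subtype.ext (funext fun q => heq2 q.1 q.2 i j))
    (Subtype.ext (funext fun q => hdiv q.1 q.2)) i
  exact congrFun (congrArg Subtype.val key) (t, x)
end
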